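/- For every interval representation R of G_γ, we have min{ν_R(u), ν_R(v)} ≥ ν(G_β) and max{ν_R(u), ν_R(v)} ≥ ν(G_γ), where u and v are the two added vertices of G_γ adjacent to all of G. -/

import Mathlib

open Set

/-- An interval representation of a simple graph `G`: each vertex `v` gets a nonempty
closed interval `[l v, r v] ⊆ ℝ`, and two distinct vertices are adjacent iff their
intervals intersect. -/
structure IntervalRep {V : Type*} (G : SimpleGraph V) where
  l : V → ℝ
  r : V → ℝ
  le : ∀ v, l v ≤ r v
  adj_iff : ∀ u v : V, u ≠ v →
    (G.Adj u v ↔ (Icc (l u) (r u) ∩ Icc (l v) (r v)).Nonempty)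

namespace IntervalRep

variable {V : Type*} {G : SimpleGraph V}

/-- The interval of a vertex. -/
def itv (R : IntervalRep G) (v : V) : Set ℝ := Icc (R.l v) (R.r v)

/-- The nesting `ν(R)`: the maximum length of a chain of strictly nested vertex intervals. -/
noncomputable def nesting (R : IntervalRep G) : ℕ :=
  sSup {k : ℕ | ∃ f : Fin k → V, ∀ i j : Fin k, i < j → R.itv (f i) ⊂ R.itv (f j)}

/-- `ν_R(x)`: the maximum length of a chain of strictly nested vertex intervals whose
outermost interval is `I(x)` (counting `x` itself). -/
noncomputable def nuAt (R : IntervalRep G) (x : V) : ℕ :=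
  sSup {k : ℕ | ∃ f : Fin k → V,
    (∀ i j : Fin k, i < j → R.itv (f i) ⊂ R.itv (f j)) ∧
    ∃ h : 0 < k, f ⟨k - 1, by omega⟩ = x}

end IntervalRep

/-- A graph is an interval graph if it admits an interval representation. -/
def IsIntervalGraph {V : Type*} (G : SimpleGraph V) : Prop := Nonempty (IntervalRep G)

/-- The nesting number `ν(G)`: the minimum nesting over all interval representations. -/
noncomputable def nu {V : Type*} (G : SimpleGraph V) : ℕ :=
  sInf {n : ℕ | ∃ R : IntervalRep G, R.nesting = n}

/-- `G_α`: add vertices `u, a₁, a₂, b₁, b₂` (coded as `0,1,2,3,4`), with `u` adjacent to all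
of `G` and to `a₁, b₁`; `a₁ ~ a₂` and `b₁ ~ b₂`. -/
def Galpha {V : Type*} (G : SimpleGraph V) : SimpleGraph (V ⊕ Fin 5) :=
  SimpleGraph.fromRel fun x y =>
    match x, y with
    | Sum.inl a, Sum.inl b => G.Adj a b
    | Sum.inl _, Sum.inr i => i = 0
    | Sum.inr _, Sum.inl _ => False
    | Sum.inr i, Sum.inr j =>
        i = 0 ∧ j = 1 ∨ i = 1 ∧ j = 2 ∨ i = 0 ∧ j = 3 ∨ i = 3 ∧ j = 4

/-- `G_β`: add vertices `u, a₁, a₂` (coded as `0,1,2`), with `u` adjacent to all of `G`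
and to `a₁`; `a₁ ~ a₂`. -/
def Gbeta {V : Type*} (G : SimpleGraph V) : SimpleGraph (V ⊕ Fin 3) :=
  SimpleGraph.fromRel fun x y =>
    match x, y with
    | Sum.inl a, Sum.inl b => G.Adj a b
    | Sum.inl _, Sum.inr i => i = 0
    | Sum.inr _, Sum.inl _ => False
    | Sum.inr i, Sum.inr j => i = 0 ∧ j = 1 ∨ i = 1 ∧ j = 2

/-- `G_γ`: add vertices `u, v, a₁, a₂, b₁, b₂` (coded as `0,1,2,3,4,5`), with `u ~ v`, both
adjacent to all of `G`; `u ~ a₁`, `a₁ ~ a₂`, `v ~ b₁`, `b₁ ~ b₂`. -/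
def Ggamma {V : Type*} (G : SimpleGraph V) : SimpleGraph (V ⊕ Fin 6) :=
  SimpleGraph.fromRel fun x y =>
    match x, y with
    | Sum.inl a, Sum.inl b => G.Adj a b
    | Sum.inl _, Sum.inr i => i = 0 ∨ i = 1
    | Sum.inr _, Sum.inl _ => False
    | Sum.inr i, Sum.inr j =>
        i = 0 ∧ j = 1 ∨ i = 0 ∧ j = 2 ∨ i = 2 ∧ j = 3 ∨ i = 1 ∧ j = 4 ∨ i = 4 ∧ j = 5

/-- The disjoint union of a family of graphs, on the sigma type of their vertex sets. -/
def sigmaGraph {p : ℕ} {V : Fin p → Type*} (G : ∀ i, SimpleGraph (V i)) :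
    SimpleGraph (Σ i, V i) :=
  SimpleGraph.fromRel fun x y => ∃ h : x.1 = y.1, (G y.1).Adj (h ▸ x.2) y.2

/-- The graph obtained from `H` by adding one new vertex adjacent to every vertex of `H`. -/
def joinVertex {W : Type*} (H : SimpleGraph W) : SimpleGraph (W ⊕ Unit) :=
  SimpleGraph.fromRel fun x y =>
    match x, y with
    | Sum.inl a, Sum.inl b => H.Adj a b
    | Sum.inl _, Sum.inr _ => True
    | _, _ => False

lemma icc_ss {a b c d : ℝ} (h : a ≤ b) :
    Icc a b ⊂ Icc c d ↔ c ≤ a ∧ b ≤ d ∧ (c < a ∨ b < d) := by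
  rw [ssubset_iff_subset_not_subset, Icc_subset_Icc_iff h]
  constructor
  · rintro ⟨⟨h1, h2⟩, h3⟩
    refine ⟨h1, h2, ?_⟩
    by_contra hc
    push Not at hc
    exact h3 (Icc_subset_Icc hc.1 hc.2)
  · rintro ⟨h1, h2, h3⟩
    refine ⟨⟨h1, h2⟩, fun hc => ?_⟩
    rw [Icc_subset_Icc_iff (by linarith)] at hc
    rcases h3 with h3 | h3 <;> linarith [hc.1, hc.2]

lemma icc_meet {a b c d : ℝ} (h : a ≤ b) (h' : c ≤ d) :
    (Icc a b ∩ Icc c d).Nonempty ↔ a ≤ d ∧ c ≤ b := by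
  rw [Icc_inter_Icc, nonempty_Icc]
  simp [h, h']
  tauto

/-- Numeric strict nesting. -/
def Nst (a b c d : ℝ) : Prop := c ≤ a ∧ b ≤ d ∧ (c < a ∨ b < d)

lemma IntervalRep.itv_ss {W : Type*} {H : SimpleGraph W} (R : IntervalRep H) (x y : W) :
    R.itv x ⊂ R.itv y ↔ Nst (R.l x) (R.r x) (R.l y) (R.r y) := icc_ss (R.le x)

lemma IntervalRep.le_nuAt {W : Type*} [Finite W] {H : SimpleGraph W} (R : IntervalRep H) (x : W)
    (n : ℕ) (g : Fin n → W) (hg : ∀ i j, i < j → R.itv (g i) ⊂ R.itv (g j))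
    (hx : ∀ i, R.itv (g i) ⊂ R.itv x) : n + 1 ≤ R.nuAt x := by
  have := Fintype.ofFinite W
  apply le_csSup
  · refine ⟨Fintype.card W, ?_⟩
    rintro k ⟨f, hf, -⟩
    have : Function.Injective f := by
      intro i j hij
      by_contra hne
      rcases lt_or_gt_of_ne hne with h | h
      · have := hf _ _ h
        rw [hij] at this
        exact this.2 this.1
      · have := hf _ _ h
        rw [hij] at this
        exact this.2 this.1
    simpa using Fintype.card_le_of_injective f this
  · refine ⟨Fin.snoc (α := fun _ => W) g x, ?_, Nat.succ_pos _, ?_⟩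
    · intro i j hij
      induction j using Fin.lastCases with
      | last =>
        induction i using Fin.lastCases with
        | last => exact absurd hij (lt_irrefl _)
        | cast i => simpa using hx i
      | cast j =>
        induction i using Fin.lastCases with
        | last => exact absurd hij (not_lt.2 (Fin.le_last _))
        | cast i => simpa using hg i j (by simpa using hij)
    · exact Fin.snoc_last (α := fun _ => W) x g

lemma nu_le_of {W : Type*} {H : SimpleGraph W} (R : IntervalRep H) (N : ℕ)
    (h : ∀ n (f : Fin (n + 1) → W),
      (∀ i j, i < j → R.itv (f i) ⊂ R.itv (f j)) → n + 1 ≤ N) : nu H ≤ N := by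
  refine le_trans (Nat.sInf_le ⟨R, rfl⟩) ?_
  apply csSup_le'
  rintro k ⟨f, hf⟩
  cases k with
  | zero => exact Nat.zero_le _
  | succ n => exact h n f hf

lemma beta_data {V : Type*} (G : SimpleGraph V) (l r : V → ℝ) (lu ru : ℝ) (N : ℕ)
    (hle : ∀ x, l x ≤ r x) (hu : lu < ru)
    (hadj : ∀ x y, x ≠ y → (G.Adj x y ↔ l x ≤ r y ∧ l y ≤ r x))
    (h1 : ∀ x, lu ≤ r x) (h2 : ∀ x, r x < ru)
    (hN : ∀ n (g : Fin n → V),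
      (∀ i j, i < j → Nst (l (g i)) (r (g i)) (l (g j)) (r (g j))) →
      (∀ i, lu ≤ l (g i)) → n + 1 ≤ N) : nu (Gbeta G) ≤ N := by
  classical
  set l' : V → ℝ := fun x => if lu ≤ l x then l x else lu - (ru - r x) with hl'
  have e1 : ∀ x, lu ≤ l x → l' x = l x := fun x hx => by simp [hl', hx]
  have e2 : ∀ x, ¬ lu ≤ l x → l' x = lu - (ru - r x) := fun x hx => by simp [hl', hx]
  have hle' : ∀ x, l' x ≤ r x := by
    intro x
    by_cases hx : lu ≤ l x
    · rw [e1 x hx]; exact hle x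
    · rw [e2 x hx]; linarith
  have hadj' : ∀ x y, x ≠ y → (G.Adj x y ↔ l' x ≤ r y ∧ l' y ≤ r x) := by
    intro x y hxy
    rw [hadj x y hxy]
    have := h1 x
    have := h1 y
    have := h2 x
    have := h2 y
    by_cases hx : lu ≤ l x <;> by_cases hy : lu ≤ l y
    · rw [e1 x hx, e1 y hy]
    · rw [e1 x hx, e2 y hy]
      constructor <;> rintro ⟨_, _⟩ <;> constructor <;> linarith
    · rw [e2 x hx, e1 y hy]
      constructor <;> rintro ⟨_, _⟩ <;> constructor <;> linarith
    · rw [e2 x hx, e2 y hy]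
      constructor <;> rintro ⟨_, _⟩ <;> constructor <;> linarith
  have hlru : ∀ x, l' x ≤ ru := fun x => (hle' x).trans (h2 x).le
  let R : IntervalRep (Gbeta G) :=
    { l := Sum.elim l' ![lu, ru, ru + 1]
      r := Sum.elim r ![ru, ru + 2, ru + 3]
      le := by
        rintro (x | i)
        · exact hle' x
        · fin_cases i <;> simp <;> linarith
      adj_iff := by
        have key : ∀ a : V ⊕ Fin 3, Sum.elim l' ![lu, ru, ru + 1] a ≤
            Sum.elim r ![ru, ru + 2, ru + 3] a := by
          rintro (x | i)
          · exact hle' x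
          · fin_cases i <;> simp <;> linarith
        intro a b hab
        rw [icc_meet (key a) (key b)]
        rcases a with x | i <;> rcases b with y | j
        · have hxy : x ≠ y := fun h => hab (by rw [h])
          simp [Gbeta, hxy, G.adj_comm y x]
          exact hadj' x y hxy
        · have := h1 x
          have := h2 x
          have := hlru x
          fin_cases j <;> simp [Gbeta] <;> (try constructor) <;> intros <;> linarith
        · have := h1 y
          have := h2 y
          have := hlru y
          fin_cases i <;> simp [Gbeta] <;> (try constructor) <;> intros <;> linarith
        · fin_cases i <;> fin_cases j <;> simp [Gbeta] at hab ⊢ <;> (try constructor) <;> (try intros) <;> linarith }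
  apply nu_le_of R
  intro n f hf
  have hmax : ∀ a b, R.itv a ⊂ R.itv b → ∃ y, a = Sum.inl y ∧ lu ≤ l y := by
    intro a b hab
    rw [R.itv_ss] at hab
    obtain ⟨p1, p2, p3⟩ := hab
    rcases a with x | i
    · refine ⟨x, rfl, ?_⟩
      by_contra hx
      have hx1 := e2 x hx
      have := h2 x
      rcases b with y | j
      · simp only [R, Sum.elim_inl] at p1 p2 p3
        by_cases hy : lu ≤ l y
        · rw [e1 y hy] at p1
          linarith
        · have := e2 y hy
          rcases p3 with p3 | p3 <;> linarith
      · fin_cases j <;> simp [R] at p1 p2 p3 <;> linarith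
    · exfalso
      rcases b with y | j
      · have := h2 y
        fin_cases i <;> simp [R] at p1 p2 p3 <;> linarith
      · fin_cases i <;> fin_cases j <;> simp [R] at p1 p2 p3 <;> linarith
  have : ∀ i : Fin n, ∃ y, f i.castSucc = Sum.inl y ∧ lu ≤ l y :=
    fun i => hmax _ _ (hf i.castSucc (Fin.last n) (Fin.castSucc_lt_last i))
  choose g hg hgl using this
  apply hN n g _ hgl
  intro i j hij
  have := hf i.castSucc j.castSucc (by simpa using hij)
  rw [hg, hg, R.itv_ss] at this
  simpa [R, e1 _ (hgl i), e1 _ (hgl j)] using this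

set_option maxHeartbeats 4000000 in
/-- `p` is the left one of the two universal vertices, `q` the right one. -/
lemma gamma_data {V : Type*} (G : SimpleGraph V) (l r : V → ℝ) (lp rp lq rq : ℝ) (N : ℕ)
    (hle : ∀ x, l x ≤ r x) (hp : lp < lq) (hq : rp < rq) (hpq : lq ≤ rp)
    (hadj : ∀ x y, x ≠ y → (G.Adj x y ↔ l x ≤ r y ∧ l y ≤ r x))
    (h1 : ∀ x, lq ≤ r x) (h2 : ∀ x, r x < rq) (h3 : ∀ x, l x ≤ rp) (h4 : ∀ x, lp < l x)
    (hN : ∀ n (g : Fin n → V),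
      (∀ i j, i < j → Nst (l (g i)) (r (g i)) (l (g j)) (r (g j))) →
      ((∀ i, lq ≤ l (g i)) ∨ (∀ i, r (g i) ≤ rp)) → n + 1 ≤ N) : nu (Ggamma G) ≤ N := by
  classical
  let C : V → Prop := fun x => lq ≤ l x ∨ r x ≤ rp
  set l' : V → ℝ := fun x => if C x then l x else (lp + lq) / 2 with hl'
  set r' : V → ℝ := fun x => if C x then r x else (rp + rq) / 2 with hr'
  have e1 : ∀ x, C x → l' x = l x := fun x hx => by simp [hl', hx]
  have e2 : ∀ x, ¬ C x → l' x = (lp + lq) / 2 := fun x hx => by simp [hl', hx]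
  have f1 : ∀ x, C x → r' x = r x := fun x hx => by simp [hr', hx]
  have f2 : ∀ x, ¬ C x → r' x = (rp + rq) / 2 := fun x hx => by simp [hr', hx]
  have n1 : ∀ x, ¬ C x → l x < lq := fun x hx => by
    by_contra h; exact hx (Or.inl (not_lt.1 h))
  have n2 : ∀ x, ¬ C x → rp < r x := fun x hx => by
    by_contra h; exact hx (Or.inr (not_lt.1 h))
  have g0 : ∀ x, l' x ≤ r' x := by
    intro x
    by_cases hx : C x
    · rw [e1 x hx, f1 x hx]; exact hle x
    · rw [e2 x hx, f2 x hx]; linarith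
  have g1 : ∀ x, lq ≤ r' x := by
    intro x
    by_cases hx : C x
    · rw [f1 x hx]; exact h1 x
    · rw [f2 x hx]; linarith
  have g2 : ∀ x, r' x < rq := by
    intro x
    by_cases hx : C x
    · rw [f1 x hx]; exact h2 x
    · rw [f2 x hx]; linarith
  have g3 : ∀ x, l' x ≤ rp := by
    intro x
    by_cases hx : C x
    · rw [e1 x hx]; exact h3 x
    · rw [e2 x hx]; linarith
  have g4 : ∀ x, lp < l' x := by
    intro x
    by_cases hx : C x
    · rw [e1 x hx]; exact h4 x
    · rw [e2 x hx]; linarith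
  have hadj' : ∀ x y, x ≠ y → (G.Adj x y ↔ l' x ≤ r' y ∧ l' y ≤ r' x) := by
    intro x y hxy
    rw [hadj x y hxy]
    have := h1 x
    have := h1 y
    have := h3 x
    have := h3 y
    by_cases hx : C x <;> by_cases hy : C y
    · rw [e1 x hx, e1 y hy, f1 x hx, f1 y hy]
    · rw [e1 x hx, e2 y hy, f1 x hx, f2 y hy]
      have := n1 y hy
      have := n2 y hy
      constructor <;> rintro ⟨_, _⟩ <;> constructor <;> linarith
    · rw [e2 x hx, e1 y hy, f2 x hx, f1 y hy]
      have := n1 x hx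
      have := n2 x hx
      constructor <;> rintro ⟨_, _⟩ <;> constructor <;> linarith
    · rw [e2 x hx, e2 y hy, f2 x hx, f2 y hy]
      have := n1 x hx
      have := n2 x hx
      have := n1 y hy
      have := n2 y hy
      constructor <;> rintro ⟨_, _⟩ <;> constructor <;> linarith
  have key : ∀ a : V ⊕ Fin 6,
      Sum.elim l' ![lq, lp, rq, rq + 1, lp - 2, lp - 3] a ≤
      Sum.elim r' ![rq, rp, rq + 2, rq + 3, lp, lp - 1] a := by
    rintro (x | i)
    · exact g0 x
    · fin_cases i <;> simp <;> linarith
  let R : IntervalRep (Ggamma G) :=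
    { l := Sum.elim l' ![lq, lp, rq, rq + 1, lp - 2, lp - 3]
      r := Sum.elim r' ![rq, rp, rq + 2, rq + 3, lp, lp - 1]
      le := key
      adj_iff := by
        intro a b hab
        rw [icc_meet (key a) (key b)]
        rcases a with x | i <;> rcases b with y | j
        · have hxy : x ≠ y := fun h => hab (by rw [h])
          simp [Ggamma, hxy, G.adj_comm y x]
          exact hadj' x y hxy
        · have := g0 x
          have := g1 x
          have := g2 x
          have := g3 x
          have := g4 x
          fin_cases j <;> simp [Ggamma] <;> (try constructor) <;> intros <;> linarith
        · have := g0 y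
          have := g1 y
          have := g2 y
          have := g3 y
          have := g4 y
          fin_cases i <;> simp [Ggamma] <;> (try constructor) <;> intros <;> linarith
        · fin_cases i <;> fin_cases j <;> simp [Ggamma] at hab ⊢ <;> (try constructor) <;> (try intros) <;> linarith }
  apply nu_le_of R
  intro n f hf
  have hmax : ∀ a b, R.itv a ⊂ R.itv b → ∃ y, a = Sum.inl y ∧ C y := by
    intro a b hab
    rw [R.itv_ss] at hab
    obtain ⟨p1, p2, p3⟩ := hab
    rcases a with x | i
    · refine ⟨x, rfl, ?_⟩
      by_contra hx
      have := e2 x hx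
      have := f2 x hx
      rcases b with y | j
      · simp only [R, Sum.elim_inl] at p1 p2 p3
        by_cases hy : C y
        · rw [e1 y hy] at p1
          rw [f1 y hy] at p2
          rcases hy with hy | hy <;> linarith
        · have := e2 y hy
          have := f2 y hy
          rcases p3 with p3 | p3 <;> linarith
      · fin_cases j <;> simp [R] at p1 p2 p3 <;> linarith
    · exfalso
      rcases b with y | j
      · have := g2 y
        have := g4 y
        fin_cases i <;> simp [R] at p1 p2 p3 <;> linarith
      · fin_cases i <;> fin_cases j <;> simp [R] at p1 p2 p3 <;> linarith
  have : ∀ i : Fin n, ∃ y, f i.castSucc = Sum.inl y ∧ C y :=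
    fun i => hmax _ _ (hf i.castSucc (Fin.last n) (Fin.castSucc_lt_last i))
  choose g hg hgC using this
  have hch : ∀ i j, i < j → Nst (l (g i)) (r (g i)) (l (g j)) (r (g j)) := by
    intro i j hij
    have := hf i.castSucc j.castSucc (by simpa using hij)
    rw [hg, hg, R.itv_ss] at this
    simpa [R, e1 _ (hgC i), e1 _ (hgC j), f1 _ (hgC i), f1 _ (hgC j)] using this
  apply hN n g hch
  by_cases hall : ∀ i, lq ≤ l (g i)
  · exact Or.inl hall
  · right
    push Not at hall
    obtain ⟨i, hi⟩ := hall
    have hi' : r (g i) ≤ rp := (hgC i).resolve_left (not_le.2 hi)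
    intro j
    rcases lt_trichotomy j i with h | h | h
    · exact (hch _ _ h).2.1.trans hi'
    · rw [h]; exact hi'
    · exact (hgC j).resolve_left (not_le.2 ((hch _ _ h).1.trans_lt hi))

lemma core {V : Type*} [Finite V] (G : SimpleGraph V) (R : IntervalRep (Ggamma G))
    (p q : V ⊕ Fin 6) (hp : R.l p < R.l q) (hq : R.r p < R.r q) (hpq : R.l q ≤ R.r p)
    (h1 : ∀ x : V, R.l q ≤ R.r (Sum.inl x)) (h2 : ∀ x : V, R.r (Sum.inl x) < R.r q)
    (h3 : ∀ x : V, R.l (Sum.inl x) ≤ R.r p) (h4 : ∀ x : V, R.l p < R.l (Sum.inl x)) :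
    nu (Gbeta G) ≤ R.nuAt p ∧ nu (Gbeta G) ≤ R.nuAt q ∧
    nu (Ggamma G) ≤ max (R.nuAt p) (R.nuAt q) := by
  have hadj : ∀ x y : V, x ≠ y → (G.Adj x y ↔
      R.l (Sum.inl x) ≤ R.r (Sum.inl y) ∧ R.l (Sum.inl y) ≤ R.r (Sum.inl x)) := by
    intro x y hxy
    rw [← icc_meet (R.le _) (R.le _), ← R.adj_iff _ _ (by simpa using hxy)]
    simp [Ggamma, hxy, G.adj_comm y x]
  have Nq : ∀ n (g : Fin n → V),
      (∀ i j, i < j → Nst (R.l (Sum.inl (g i))) (R.r (Sum.inl (g i)))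
        (R.l (Sum.inl (g j))) (R.r (Sum.inl (g j)))) →
      (∀ i, R.l q ≤ R.l (Sum.inl (g i))) → n + 1 ≤ R.nuAt q := by
    intro n g hg hi
    apply R.le_nuAt q n (fun i => Sum.inl (g i))
    · intro i j hij
      rw [R.itv_ss]
      exact hg i j hij
    · intro i
      rw [R.itv_ss]
      exact ⟨hi i, (h2 _).le, Or.inr (h2 _)⟩
  have Np : ∀ n (g : Fin n → V),
      (∀ i j, i < j → Nst (R.l (Sum.inl (g i))) (R.r (Sum.inl (g i)))
        (R.l (Sum.inl (g j))) (R.r (Sum.inl (g j)))) →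
      (∀ i, R.r (Sum.inl (g i)) ≤ R.r p) → n + 1 ≤ R.nuAt p := by
    intro n g hg hi
    apply R.le_nuAt p n (fun i => Sum.inl (g i))
    · intro i j hij
      rw [R.itv_ss]
      exact hg i j hij
    · intro i
      rw [R.itv_ss]
      exact ⟨(h4 _).le, hi i, Or.inl (h4 _)⟩
  refine ⟨?_, ?_, ?_⟩
  · apply beta_data G (fun x => - R.r (Sum.inl x)) (fun x => - R.l (Sum.inl x))
      (- R.r p) (- R.l p)
    · intro x
      simpa using R.le _
    · linarith
    · intro x y hxy
      rw [hadj x y hxy]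
      simp only [neg_le_neg_iff]
      tauto
    · intro x
      simpa using h3 x
    · intro x
      simpa using h4 x
    · intro n g hg hi
      apply Np n g
      · intro i j hij
        have := hg i j hij
        simp only [Nst, neg_le_neg_iff, neg_lt_neg_iff] at this ⊢
        tauto
      · intro i
        simpa using hi i
  · exact beta_data G _ _ _ _ _ (fun x => R.le _) (by linarith) hadj h1 h2 Nq
  · apply gamma_data G _ _ _ _ _ _ _ (fun x => R.le _) hp hq hpq hadj h1 h2 h3 h4
    intro n g hg hi
    rcases hi with hi | hi
    · exact le_max_of_le_right (Nq n g hg hi)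
    · exact le_max_of_le_left (Np n g hg hi)

/-- If `u ~ a ~ b` with `u` not adjacent to `b`, then `a` overhangs `u`, and everything adjacent to
`u` and not to `a` ends strictly before the corresponding end of `u`. -/
lemma overhang {lu ru la ra lb rb : ℝ} 
    (h1 : lu ≤ ra ∧ la ≤ ru) (h2 : la ≤ rb ∧ lb ≤ ra) (h3 : ¬ (lu ≤ rb ∧ lb ≤ ru)) :
    (∀ l r : ℝ, l ≤ r → (lu ≤ r ∧ l ≤ ru) → ¬ (la ≤ r ∧ l ≤ ra) → r < ru) ∨
    (∀ l r : ℝ, l ≤ r → (lu ≤ r ∧ l ≤ ru) → ¬ (la ≤ r ∧ l ≤ ra) → lu < l) := by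
  by_cases h : lu ≤ rb
  · left
    intro l r hlr h4 h5
    by_contra hc
    have : ¬ lb ≤ ru := fun h' => h3 ⟨h, h'⟩
    exact h5 ⟨by linarith, by linarith⟩
  · right
    intro l r hlr h4 h5
    by_contra hc
    exact h5 ⟨by linarith, by linarith⟩

/-- for every representation `R` of `G_γ`,
`min{ν_R(u), ν_R(v)} ≥ ν(G_β)` and `max{ν_R(u), ν_R(v)} ≥ ν(G_γ)`. -/
theorem stmt_8 {V : Type*} [Fintype V] (G : SimpleGraph V)
    (R : IntervalRep (Ggamma G)) :
    nu (Gbeta G) ≤ min (R.nuAt (Sum.inr 0)) (R.nuAt (Sum.inr 1)) ∧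
    nu (Ggamma G) ≤ max (R.nuAt (Sum.inr 0)) (R.nuAt (Sum.inr 1)) := by
  have A : ∀ x y, x ≠ y → ((Ggamma G).Adj x y ↔ R.l x ≤ R.r y ∧ R.l y ≤ R.r x) := by
    intro x y hxy
    rw [R.adj_iff x y hxy, icc_meet (R.le _) (R.le _)]
  have uv := (A (Sum.inr 0) (Sum.inr 1) (by simp)).1 (by simp [Ggamma])
  have ua := (A (Sum.inr 0) (Sum.inr 2) (by simp)).1 (by simp [Ggamma])
  have aa := (A (Sum.inr 2) (Sum.inr 3) (by simp)).1 (by simp [Ggamma])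
  have ua' := (not_congr (A (Sum.inr 0) (Sum.inr 3) (by simp))).1 (by simp [Ggamma])
  have vb := (A (Sum.inr 1) (Sum.inr 4) (by simp)).1 (by simp [Ggamma])
  have bb := (A (Sum.inr 4) (Sum.inr 5) (by simp)).1 (by simp [Ggamma])
  have vb' := (not_congr (A (Sum.inr 1) (Sum.inr 5) (by simp))).1 (by simp [Ggamma])
  have av := (not_congr (A (Sum.inr 2) (Sum.inr 1) (by simp))).1 (by simp [Ggamma])
  have bu := (not_congr (A (Sum.inr 4) (Sum.inr 0) (by simp))).1 (by simp [Ggamma])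
  have ux := fun x : V => (A (Sum.inr 0) (Sum.inl x) (by simp)).1 (by simp [Ggamma])
  have vx := fun x : V => (A (Sum.inr 1) (Sum.inl x) (by simp)).1 (by simp [Ggamma])
  have ax := fun x : V =>
    (not_congr (A (Sum.inr 2) (Sum.inl x) (by simp))).1 (by simp [Ggamma])
  have bx := fun x : V =>
    (not_congr (A (Sum.inr 4) (Sum.inl x) (by simp))).1 (by simp [Ggamma])
  have ou := overhang ua aa ua'
  have ov := overhang vb bb vb'
  rcases ou with ou | ou <;> rcases ov with ov | ov
  · exact absurd (ou _ _ (R.le _) uv av) (not_lt.2 (ov _ _ (R.le _) uv.symm bu).le)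
  · have := core G R (Sum.inr 1) (Sum.inr 0) (ov _ _ (R.le _) uv.symm bu)
      (ou _ _ (R.le _) uv av) uv.1 (fun x => (ux x).1)
      (fun x => ou _ _ (R.le _) (ux x) (ax x)) (fun x => (vx x).2)
      (fun x => ov _ _ (R.le _) (vx x) (bx x))
    exact ⟨le_min this.2.1 this.1, by rw [max_comm]; exact this.2.2⟩
  · have := core G R (Sum.inr 0) (Sum.inr 1) (ou _ _ (R.le _) uv av)
      (ov _ _ (R.le _) uv.symm bu) uv.2 (fun x => (vx x).1)
      (fun x => ov _ _ (R.le _) (vx x) (bx x)) (fun x => (ux x).2)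
      (fun x => ou _ _ (R.le _) (ux x) (ax x))
    exact ⟨le_min this.1 this.2.1, this.2.2⟩
  · exact absurd (ou _ _ (R.le _) uv av) (not_lt.2 (ov _ _ (R.le _) uv.symm bu).le)
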